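/- arXiv:2111.00120 — 5 statements merged into one kernel-verified Lean document; each statement's English description precedes it below -/
import Mathlib

section
/- Let A_1, …, A_n and C be subspaces of a finite-dimensional vector space V over a field such that C ≤ A_1 + ⋯ + A_n and C ∩ (Σ_{i≠k} A_i) = 0 for every k ∈ {1,…,n}. Then there exist subspaces Ā_i ≤ A_i, for i = 1, …, n, such that: (i) Ā_k ∩ (Σ_{i≠k} A_i) = 0 for every k; (ii) the sum W := Ā_1 + ⋯ + Ā_n is direct, C ≤ W, and for each k the sum Ā_1 + ⋯ + Ā_{k−1} + C + Ā_{k+1} + ⋯ + Ā_n is direct (that is, (Ā_1, …, Ā_n, C) is a tuple of complementary vector spaces in W); (iii) dim(C) = dim(Ā_i) for every i. -/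
/-- Every vector of a subspace of `⨆ i, A i` decomposes, linearly in that vector, as a sum of
vectors of the `A i`. -/
theorem exists_linearMap_sum_eq_of_le_iSup {F V ι : Type*} [Field F] [AddCommGroup V] [Module F V]
    [Fintype ι] (A : ι → Submodule F V) (C : Submodule F V) (hC : C ≤ ⨆ i, A i) :
    ∃ f : ι → C →ₗ[F] V, (∀ i c, f i c ∈ A i) ∧ ∀ c, ∑ i, f i c = c := by
  classical
  let g : (Π₀ i, A i) →ₗ[F] V := DFinsupp.lsum ℕ fun i => (A i).subtype
  have hg : C ≤ g.range := hC.trans (Submodule.iSup_eq_range_dfinsupp_lsum A).le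
  obtain ⟨s, hs⟩ := g.rangeRestrict.exists_rightInverse_of_surjective g.range_rangeRestrict
  refine ⟨fun i => (A i).subtype ∘ₗ DFinsupp.lapply i ∘ₗ s ∘ₗ Submodule.inclusion hg,
    fun i c => Subtype.property _, fun c => ?_⟩
  have h := congrArg Subtype.val (LinearMap.congr_fun hs (Submodule.inclusion hg c))
  have hsum : g (s (Submodule.inclusion hg c)) = c := h
  rw [DFinsupp.lsum_apply_apply, DFinsupp.sumAddHom_apply,
    DFinsupp.sum_eq_sum_fintype _ (by simp)] at hsum
  exact hsum


/-- If `C ≤ A 1 + ⋯ + A n` and `C ⊓ (Σ_{i ≠ k} A i) = 0` for every `k`,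
then there are subspaces `Ā i ≤ A i` such that (i) `Ā k ⊓ (Σ_{i ≠ k} A i) = 0` for every `k`;
(ii) the sum `W = Ā 1 + ⋯ + Ā n` is direct, `C ≤ W`, and for each `k` the sum
`Ā 1 + ⋯ + Ā (k-1) + C + Ā (k+1) + ⋯ + Ā n` is direct (so `(Ā 1, …, Ā n, C)` is a tuple of
complementary vector spaces in `W`); and (iii) `dim C = dim (Ā i)` for every `i`. -/
theorem statement1 {F V : Type*} [Field F] [AddCommGroup V] [Module F V]
    [FiniteDimensional F V] {n : ℕ}
    (A : Fin n → Submodule F V) (C : Submodule F V)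
    (hC1 : C ≤ ⨆ i, A i)
    (hC2 : ∀ k, C ⊓ (⨆ (i) (_ : i ≠ k), A i) = ⊥) :
    ∃ Abar : Fin n → Submodule F V,
      (∀ i, Abar i ≤ A i) ∧
      (∀ k, Abar k ⊓ (⨆ (i) (_ : i ≠ k), A i) = ⊥) ∧
      iSupIndep Abar ∧
      C ≤ (⨆ i, Abar i) ∧
      (∀ k, iSupIndep (Function.update Abar k C)) ∧
      (∀ i, Module.finrank F C = Module.finrank F (Abar i)) := by
  classical
  obtain ⟨f, hfA, hsum⟩ := exists_linearMap_sum_eq_of_le_iSup A C hC1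
  have hAle : ∀ {i k}, i ≠ k → A i ≤ ⨆ (j) (_ : j ≠ k), A j := fun {i k} h =>
    le_iSup₂_of_le i h le_rfl
  have hzero : ∀ k (c : C), (c : V) ∈ (⨆ (i) (_ : i ≠ k), A i) → c = 0 := fun k c hc =>
    Subtype.ext ((Submodule.mem_bot F).1 (hC2 k ▸ ⟨c.2, hc⟩))
  have hfzero : ∀ k c, f k c ∈ (⨆ (i) (_ : i ≠ k), A i) → c = 0 := by
    intro k c hc
    refine hzero k c ?_
    rw [← hsum c]
    refine Submodule.sum_mem _ fun i _ => ?_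
    rcases eq_or_ne i k with rfl | h
    · exact hc
    · exact hAle h (hfA i c)
  have hle : ∀ i, (f i).range ≤ A i := by
    rintro i _ ⟨c, rfl⟩
    exact hfA i c
  have hdisj : ∀ k, (f k).range ⊓ (⨆ (i) (_ : i ≠ k), A i) = ⊥ := by
    refine fun k => (Submodule.eq_bot_iff _).2 ?_
    rintro _ ⟨⟨c, rfl⟩, hc⟩
    rw [hfzero k c hc, map_zero]
  refine ⟨fun i => (f i).range, hle, hdisj, fun k => ?_, fun c hc => ?_, fun k i => ?_,
    fun i => ?_⟩
  · exact (disjoint_iff.2 (hdisj k)).mono_right (iSup₂_mono fun i _ => hle i)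
  · rw [show c = ∑ i, f i ⟨c, hc⟩ from (hsum ⟨c, hc⟩).symm]
    exact Submodule.sum_mem _ fun i _ => Submodule.mem_iSup_of_mem i ⟨_, rfl⟩
  · rcases eq_or_ne i k with rfl | hik
    · rw [Function.update_self]
      refine (disjoint_iff.2 (hC2 i)).mono_right (iSup₂_mono fun j hj => ?_)
      rw [Function.update_of_ne hj]
      exact hle j
    · rw [Function.update_of_ne hik]
      have hsup : (⨆ (j) (_ : j ≠ i), Function.update (fun i => (f i).range) k C j) ≤
          C ⊔ ⨆ (j) (_ : j ≠ i ∧ j ≠ k), A j := by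
        refine iSup₂_le fun j hj => ?_
        rcases eq_or_ne j k with rfl | hjk
        · rw [Function.update_self]
          exact le_sup_left
        · rw [Function.update_of_ne hjk]
          exact (hle j).trans (le_sup_of_le_right (le_iSup₂_of_le j ⟨hj, hjk⟩ le_rfl))
      refine Disjoint.mono_right hsup (Submodule.disjoint_def.2 ?_)
      rintro _ ⟨a, rfl⟩ ha
      obtain ⟨c, hc, y, hy, hcy⟩ := Submodule.mem_sup.1 ha
      have hyk : y ∈ ⨆ (j) (_ : j ≠ k), A j :=
        (iSup₂_le fun j hj => hAle hj.2 : (⨆ (j) (_ : j ≠ i ∧ j ≠ k), A j) ≤ _) hy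
      have hyi : y ∈ ⨆ (j) (_ : j ≠ i), A j :=
        (iSup₂_le fun j hj => hAle hj.1 : (⨆ (j) (_ : j ≠ i ∧ j ≠ k), A j) ≤ _) hy
      have hc0 : (⟨c, hc⟩ : C) = 0 := by
        refine hzero k _ ?_
        change c ∈ _
        rw [eq_sub_of_add_eq hcy]
        exact Submodule.sub_mem _ (hAle hik (hfA i a)) hyk
      have hfy : f i a = y := by
        rw [← hcy, show c = 0 from congrArg Subtype.val hc0, zero_add]
      rw [hfzero i a (hfy ▸ hyi), map_zero]
  · refine (LinearMap.finrank_range_of_inj ?_).symm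
    refine (injective_iff_map_eq_zero _).2 fun c hc => hfzero i c ?_
    rw [hc]
    exact Submodule.zero_mem _
end

section
/- Let B = (b_{ji}) be an n×n matrix with entries in {0,1}, with column supports S_i := {j : b_{ji} = 1}, and assume 1 ≤ |S_i| < n for every column (𝓑''' = ∅). Let A_{e_1}, …, A_{e_n}, the subspaces B_{e_{S_j}} for each column e_{S_j} ∈ 𝓑', and C be subspaces of a finite-dimensional vector space V over a field, such that: (a) C ≤ A_{e_1} + ⋯ + A_{e_n} and C ≤ (Σ_{i∉S_j} A_{e_i}) + B_{e_{S_j}} for each e_{S_j} ∈ 𝓑'; (b) C ∩ (Σ_{j≠i} A_{e_j}) = 0 for each i ∈ {1,…,n}; (c) C ∩ ((Σ_{i∉S_j, i≠k} A_{e_i}) + B_{e_{S_j}}) = 0 for each e_{S_j} ∈ 𝓑' and each k ∉ S_j. Then there exist subspaces Ā_{e_i} ≤ A_{e_i} for i ∈ {1,…,n}, and subspaces A_{e_i}^{S_j} ≤ A_{e_i} and B̂_{e_{S_j}} ≤ B_{e_{S_j}} for each e_{S_j} ∈ 𝓑' and each i ∉ S_j, such that: (Ā_{e_1}, …, Ā_{e_n},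 C) is a tuple of complementary vector spaces; for each e_{S_j} ∈ 𝓑', the tuple ((A_{e_i}^{S_j})_{i∉S_j}, B̂_{e_{S_j}}, C) is a tuple of complementary vector spaces; and every one of these subspaces has dimension equal to dim(C). -/
/-- A tuple `(X 1, …, X m, C)` of subspaces is a *tuple of complementary vector spaces*
inside `W := X 1 + ⋯ + X m` if the sum of the `X i` is direct, `C ≤ W`, and for each `k`
the sum `X 1 + ⋯ + X (k-1) + C + X (k+1) + ⋯ + X m` is direct. -/
def IsComplementaryTuple {F V : Type*} [Field F] [AddCommGroup V] [Module F V]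
    {ι : Type*} [DecidableEq ι] (X : ι → Submodule F V) (C : Submodule F V) : Prop :=
  iSupIndep X ∧ C ≤ (⨆ i, X i) ∧ ∀ k, iSupIndep (Function.update X k C)

/-- If `C` lies in the sum of the `X i` and meets each sum omitting one `X k` trivially, then
the `X i` can be shrunk to subspaces of dimension `dim C` that are complementary with `C`. -/
theorem exists_isComplementaryTuple_le {F V : Type*} [Field F] [AddCommGroup V] [Module F V]
    {ι : Type*} [DecidableEq ι] [Finite ι] (X : ι → Submodule F V) (C : Submodule F V)
    (hC : C ≤ ⨆ i, X i) (hd : ∀ k, C ⊓ (⨆ (j) (_ : j ≠ k), X j) = ⊥) :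
    ∃ Y : ι → Submodule F V, (∀ i, Y i ≤ X i) ∧ IsComplementaryTuple Y C ∧
      ∀ i, Module.finrank F (Y i) = Module.finrank F C := by
  have := Fintype.ofFinite ι
  obtain ⟨f, hfX, hf⟩ : ∃ f : ι → C →ₗ[F] V, (∀ i c, f i c ∈ X i) ∧
      ∀ c : C, ∑ i, f i c = (c : V) := by
    let φ : (∀ i, X i) →ₗ[F] V := ∑ i, (X i).subtype ∘ₗ LinearMap.proj i
    have hφ : C ≤ LinearMap.range φ := by
      refine hC.trans (iSup_le fun i x hx => ⟨Pi.single i ⟨x, hx⟩, ?_⟩)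
      simp only [φ, LinearMap.sum_apply, LinearMap.comp_apply, LinearMap.proj_apply,
        Submodule.subtype_apply]
      rw [Finset.sum_eq_single i]
      · simp
      · intro j _ hj
        simp [hj]
      · simp
    obtain ⟨s, hs⟩ := φ.rangeRestrict.exists_rightInverse_of_surjective φ.range_rangeRestrict
    refine ⟨fun i => (X i).subtype ∘ₗ LinearMap.proj i ∘ₗ s ∘ₗ Submodule.inclusion hφ,
      fun i c => by simp, fun c => ?_⟩
    have h := congrArg Subtype.val (LinearMap.congr_fun hs (Submodule.inclusion hφ c))
    simpa [φ, LinearMap.sum_apply] using h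
  have mem_others : ∀ (k : ι) (c : C), f k c ∈ (⨆ (j) (_ : j ≠ k), X j) → c = 0 := by
    intro k c hk
    have hc : (c : V) ∈ C ⊓ (⨆ (j) (_ : j ≠ k), X j) := by
      refine ⟨c.2, ?_⟩
      rw [← hf c]
      refine Submodule.sum_mem _ fun i _ => ?_
      by_cases hi : i = k
      · exact hi ▸ hk
      · exact Submodule.mem_iSup_of_mem i (Submodule.mem_iSup_of_mem hi (hfX i c))
    rw [hd k] at hc
    simpa using hc
  have hYX : ∀ i, LinearMap.range (f i) ≤ X i := by
    rintro i _ ⟨c, rfl⟩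
    exact hfX i c
  have hind : iSupIndep fun i => LinearMap.range (f i) := by
    intro k
    rw [Submodule.disjoint_def]
    rintro _ ⟨c, rfl⟩ hk
    rw [mem_others k c (iSup₂_mono (fun j _ => hYX j) hk), map_zero]
  refine ⟨fun i => LinearMap.range (f i), hYX, ⟨hind, ?_, ?_⟩, ?_⟩
  · intro c hc
    rw [show c = ∑ i, f i ⟨c, hc⟩ from (hf ⟨c, hc⟩).symm]
    exact Submodule.sum_mem _ fun i _ => Submodule.mem_iSup_of_mem i ⟨_, rfl⟩
  · intro k i
    rw [Submodule.disjoint_def]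
    intro x hx hx'
    by_cases hi : i = k
    · subst hi
      rw [Function.update_self] at hx
      have h : x ∈ C ⊓ (⨆ (j) (_ : j ≠ i), X j) := by
        refine ⟨hx, (iSup₂_mono fun j hj => ?_ : _ ≤ ⨆ (j) (_ : j ≠ i), X j) hx'⟩
        rw [Function.update_of_ne hj]
        exact hYX j
      simpa [hd i] using h
    · rw [Function.update_of_ne hi] at hx
      have hle : (⨆ (j) (_ : j ≠ i), Function.update (fun i => LinearMap.range (f i)) k C j) ≤
          C ⊔ ⨆ (j) (_ : j ≠ i ∧ j ≠ k), LinearMap.range (f j) := by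
        refine iSup₂_le fun j hj => ?_
        by_cases hjk : j = k
        · subst hjk
          rw [Function.update_self]
          exact le_sup_left
        · rw [Function.update_of_ne hjk]
          exact le_sup_of_le_right
            (le_iSup₂_of_le (f := fun j (_ : j ≠ i ∧ j ≠ k) => LinearMap.range (f j))
              j ⟨hj, hjk⟩ le_rfl)
      obtain ⟨c, hc, y, hy, rfl⟩ := Submodule.mem_sup.1 (hle hx')
      have h : c ∈ C ⊓ (⨆ (j) (_ : j ≠ k), X j) := by
        refine ⟨hc, ?_⟩
        rw [← add_sub_cancel_right c y]
        refine Submodule.sub_mem _ ?_ ?_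
        · exact Submodule.mem_iSup_of_mem i (Submodule.mem_iSup_of_mem hi (hYX i hx))
        · exact (iSup₂_le fun j hj => (hYX j).trans
            (le_iSup₂_of_le (f := fun j (_ : j ≠ k) => X j) j hj.2 le_rfl)) hy
      rw [hd k, Submodule.mem_bot] at h
      subst h
      rw [zero_add] at hx ⊢
      refine Submodule.disjoint_def.1 (hind i) y hx ?_
      exact (iSup₂_le fun j hj =>
        le_iSup₂_of_le (f := fun j (_ : j ≠ i) => LinearMap.range (f j)) j hj.1 le_rfl) hy
  · intro i
    refine LinearMap.finrank_range_of_inj ((injective_iff_map_eq_zero _).2 fun c hc => ?_)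
    exact mem_others i c (hc ▸ Submodule.zero_mem _)

/-- For a 0-1 `n × n` matrix `B` with column supports `S i` satisfying
`1 ≤ |S i| < n`, and subspaces `A i` (`i ∈ [n]`), `Bs j` (for the columns `j ∈ 𝓑'`, i.e.
`1 < |S j|`) and `C` satisfying (a) `C ≤ Σ_i A i` and `C ≤ Σ_{i ∉ S j} A i + Bs j` for
`j ∈ 𝓑'`; (b) `C ⊓ Σ_{j ≠ i} A j = 0`; (c) `C ⊓ (Σ_{i ∉ S j, i ≠ k} A i + Bs j) = 0` for
`j ∈ 𝓑'`, `k ∉ S j`; there exist `Ā i ≤ A i`, `A^{S j} i ≤ A i` (for `j ∈ 𝓑'`, `i ∉ S j`)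
and `B̂ j ≤ Bs j` such that `(Ā 1, …, Ā n, C)` and, for each `j ∈ 𝓑'`,
`((A^{S j} i)_{i ∉ S j}, B̂ j, C)` are tuples of complementary vector spaces, and all these
subspaces have dimension `dim C`. -/
theorem statement3 {F V : Type*} [Field F] [AddCommGroup V] [Module F V]
    [FiniteDimensional F V] {n : ℕ}
    (B : Matrix (Fin n) (Fin n) ℤ)
    (hB01 : ∀ j i, B j i = 0 ∨ B j i = 1)
    (S : Fin n → Finset (Fin n))
    (hS : ∀ i, S i = Finset.univ.filter fun j => B j i = 1)
    (hcard : ∀ i, 1 ≤ (S i).card ∧ (S i).card < n)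
    (A Bs : Fin n → Submodule F V) (C : Submodule F V)
    (ha1 : C ≤ ⨆ i, A i)
    (ha2 : ∀ j, 1 < (S j).card → C ≤ (⨆ (i) (_ : i ∉ S j), A i) ⊔ Bs j)
    (hb : ∀ i, C ⊓ (⨆ (j) (_ : j ≠ i), A j) = ⊥)
    (hc : ∀ j, 1 < (S j).card → ∀ k ∉ S j,
      C ⊓ ((⨆ (i) (_ : i ∉ S j ∧ i ≠ k), A i) ⊔ Bs j) = ⊥) :
    ∃ (Abar : Fin n → Submodule F V) (Asup : Fin n → Fin n → Submodule F V)
      (Bhat : Fin n → Submodule F V),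
      (∀ i, Abar i ≤ A i) ∧
      (∀ j, 1 < (S j).card → (∀ i ∉ S j, Asup j i ≤ A i) ∧ Bhat j ≤ Bs j) ∧
      IsComplementaryTuple Abar C ∧
      (∀ j, 1 < (S j).card →
        IsComplementaryTuple
          (fun o : Option {i : Fin n // i ∉ S j} =>
            Option.elim o (Bhat j) fun i => Asup j i.1) C) ∧
      (∀ i, Module.finrank F (Abar i) = Module.finrank F C) ∧
      (∀ j, 1 < (S j).card →
        Module.finrank F (Bhat j) = Module.finrank F C ∧
          ∀ i ∉ S j, Module.finrank F (Asup j i) = Module.finrank F C) := by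
  obtain ⟨Abar, hA, hAC, hAdim⟩ := exists_isComplementaryTuple_le A C ha1 hb
  have key : ∀ j, ∃ Y : Option {i : Fin n // i ∉ S j} → Submodule F V, 1 < (S j).card →
      (∀ o, Y o ≤ Option.elim o (Bs j) fun i => A i.1) ∧ IsComplementaryTuple Y C ∧
        ∀ o, Module.finrank F (Y o) = Module.finrank F C := by
    intro j
    by_cases hj : 1 < (S j).card
    swap
    · exact ⟨fun _ => ⊥, fun h => absurd h hj⟩
    obtain ⟨Y, hY⟩ := exists_isComplementaryTuple_le
      (fun o : Option {i : Fin n // i ∉ S j} => Option.elim o (Bs j) fun i => A i.1) C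
      (by
        refine (ha2 j hj).trans (sup_le (iSup₂_le fun i hi => ?_) ?_)
        · exact le_iSup (fun o : Option {i : Fin n // i ∉ S j} =>
            Option.elim o (Bs j) fun i => A i.1) (some ⟨i, hi⟩)
        · exact le_iSup (fun o : Option {i : Fin n // i ∉ S j} =>
            Option.elim o (Bs j) fun i => A i.1) none)
      (by
        rintro (_ | ⟨k, hk⟩)
        · obtain ⟨m, hm⟩ := Finset.card_pos.1 (hcard j).1
          rw [← le_bot_iff, ← hb m]
          refine inf_le_inf_left C (iSup₂_le ?_)
          rintro (_ | ⟨i, hi⟩) ho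
          · exact absurd rfl ho
          · exact le_iSup₂_of_le (f := fun j (_ : j ≠ m) => A j) i
              (fun h => hi (h ▸ hm)) le_rfl
        · rw [← le_bot_iff, ← hc j hj k hk]
          refine inf_le_inf_left C (iSup₂_le ?_)
          rintro (_ | ⟨i, hi⟩) ho
          · exact le_sup_right
          · refine le_sup_of_le_left
              (le_iSup₂_of_le (f := fun i (_ : i ∉ S j ∧ i ≠ k) => A i) i ⟨hi, ?_⟩ le_rfl)
            rintro rfl
            exact ho rfl)
    exact ⟨Y, fun _ => hY⟩
  choose Y hY using key
  refine ⟨Abar, fun j i => if hi : i ∉ S j then Y j (some ⟨i, hi⟩) else ⊥,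
    fun j => Y j none, hA, fun j hj => ⟨fun i hi => ?_, (hY j hj).1 none⟩, hAC,
    fun j hj => ?_, hAdim, fun j hj => ⟨(hY j hj).2.2 none, fun i hi => ?_⟩⟩
  · beta_reduce
    rw [dif_pos hi]
    exact (hY j hj).1 (some ⟨i, hi⟩)
  · convert (hY j hj).2.1 using 1
    funext o
    rcases o with _ | ⟨i, hi⟩
    · rfl
    · exact dif_pos hi
  · beta_reduce
    rw [dif_pos hi]
    exact (hY j hj).2.2 (some ⟨i, hi⟩)
end

section
/- Let B = (b_{ji}) be an n×n matrix with entries in {0,1} with column supports S_i := {j : b_{ji} = 1}, 𝓑''' = ∅ and |det B| = t > 1. Let F be a finite field whose characteristic does not divide t, and let A_{e_1}, …, A_{e_n}, B_{e_{S_j}} (for e_{S_j} ∈ 𝓑'), and C be subspaces of a finite-dimensional F-vector space V with C ∩ 𝓑 = 0, where 𝓑 := Σ_{e_{S_j}∈𝓑'} B_{e_{S_j}} + Σ_{e_i∈𝓑''} A_{e_i}. Suppose c ∈ C can be written as c = a_1 + ⋯ + a_n with a_i ∈ A_{e_i} for each i, and for every column e_{S_j} ∈ 𝓑' there exists b_j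 ∈ B_{e_{S_j}} with Σ_{i∈S_j} a_i = b_j. Then c = 0. -/
/-- If every column combination `∑ j, B j i • a j` of an integer square matrix lies in an additive
subgroup, then so does every `B.det • a k`. -/
theorem Matrix.det_zsmul_mem {ι M : Type*} [Fintype ι] [DecidableEq ι] [AddCommGroup M]
    (B : Matrix ι ι ℤ) (a : ι → M) (W : AddSubgroup M)
    (h : ∀ i, ∑ j, B j i • a j ∈ W) (k : ι) : B.det • a k ∈ W := by
  have key : ∑ i, B.adjugate i k • ∑ j, B j i • a j = B.det • a k := by
    simp_rw [Finset.smul_sum, smul_smul]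
    rw [Finset.sum_comm]
    simp_rw [← Finset.sum_smul]
    have hmul (j : ι) : ∑ i, B.adjugate i k * B j i = if j = k then B.det else 0 := by
      have := congrFun (congrFun B.mul_adjugate j) k
      simpa [Matrix.mul_apply, Matrix.smul_apply, Matrix.one_apply, mul_comm] using this
    simp [hmul, ite_smul]
  rw [← key]
  exact W.sum_mem fun i _ => W.zsmul_mem (h i) _


/-- For a 0-1 `n × n` matrix `B` with column supports `S i`, no full columns
(`𝓑''' = ∅`) and `|det B| = t > 1`, over a finite field `F` whose characteristic does not
divide `t`: let `A i`, `Bs j` (for columns `j ∈ 𝓑'`, i.e. `1 < |S j|`) and `C` be subspaces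
of a finite-dimensional `F`-vector space with `C ⊓ 𝓑 = 0`, where
`𝓑 = Σ_{j ∈ 𝓑'} Bs j + Σ_{e_i ∈ 𝓑''} A i`. If `c ∈ C` can be written `c = a 1 + ⋯ + a n`
with `a i ∈ A i`, and for every column `j ∈ 𝓑'` the sum `Σ_{i ∈ S j} a i` lies in `Bs j`
(i.e. equals some `b j ∈ Bs j`), then `c = 0`. -/
theorem statement5 {F : Type*} [Field F] [Fintype F] {V : Type*} [AddCommGroup V]
    [Module F V] [FiniteDimensional F V] {n : ℕ}
    (B : Matrix (Fin n) (Fin n) ℤ)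
    (hB01 : ∀ j i, B j i = 0 ∨ B j i = 1)
    (S : Fin n → Finset (Fin n))
    (hS : ∀ i, S i = Finset.univ.filter fun j => B j i = 1)
    (hBppp : ∀ i, (S i).card < n)
    (t : ℕ) (ht : 1 < t) (hdet : B.det.natAbs = t)
    (hchar : ¬ (ringChar F ∣ t))
    (A Bs : Fin n → Submodule F V) (C : Submodule F V)
    (hCB : C ⊓ ((⨆ (j) (_ : 1 < (S j).card), Bs j) ⊔
      (⨆ (j) (_ : (S j).card = 1), ⨆ i ∈ S j, A i)) = ⊥)
    (c : V) (hcC : c ∈ C)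
    (a : Fin n → V) (ha : ∀ i, a i ∈ A i) (hca : c = ∑ i, a i)
    (hb : ∀ j, 1 < (S j).card → ∑ i ∈ S j, a i ∈ Bs j) :
    c = 0 := by
  set W := (⨆ (j) (_ : 1 < (S j).card), Bs j) ⊔
    (⨆ (j) (_ : (S j).card = 1), ⨆ i ∈ S j, A i)
  have hcol (i : Fin n) : ∑ j ∈ S i, a j ∈ W := by
    rcases Nat.lt_trichotomy (S i).card 1 with h | h | h
    · rw [Finset.card_eq_zero.mp (Nat.lt_one_iff.mp h), Finset.sum_empty]
      exact W.zero_mem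
    · refine W.sum_mem fun j hj => Submodule.mem_sup_right ?_
      exact Submodule.mem_iSup_of_mem i (Submodule.mem_iSup_of_mem h
        (Submodule.mem_iSup_of_mem j (Submodule.mem_iSup_of_mem hj (ha j))))
    · exact Submodule.mem_sup_left
        (Submodule.mem_iSup_of_mem i (Submodule.mem_iSup_of_mem h (hb i h)))
  have hcomb (i : Fin n) : ∑ j, B j i • a j ∈ W.toAddSubgroup := by
    have : ∑ j, B j i • a j = ∑ j ∈ S i, a j := by
      rw [hS, Finset.sum_filter]
      refine Finset.sum_congr rfl fun j _ => ?_
      rcases hB01 j i with h | h <;> simp [h]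
    rw [this]
    exact hcol i
  have hdetF : (B.det : F) ≠ 0 := by
    rw [Ne, CharP.intCast_eq_zero_iff F (ringChar F), Int.natCast_dvd, hdet]
    exact hchar
  have haW (k : Fin n) : a k ∈ W := by
    have h : B.det • a k ∈ W := B.det_zsmul_mem a W.toAddSubgroup hcomb k
    rw [← Int.cast_smul_eq_zsmul F] at h
    exact (W.smul_mem_iff hdetF).mp h
  have hcW : c ∈ W := hca ▸ W.sum_mem fun k _ => haW k
  have hmem : c ∈ C ⊓ W := ⟨hcC, hcW⟩
  rwa [hCB, Submodule.mem_bot] at hmem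
end

section
/- Let B = (b_{ji}) be an n×n matrix with entries in {0,1} with column supports S_i := {j : b_{ji} = 1} and 𝓑''' = ∅. Let F be a finite field, and let A_{e_1}, …, A_{e_n} and B_{e_{S_j}} (for e_{S_j} ∈ 𝓑') be subspaces of an F-vector space V. Suppose c = a_1 + ⋯ + a_n with a_i ∈ A_{e_i}, and for every e_{S_j} ∈ 𝓑' there exists b_j ∈ B_{e_{S_j}} with Σ_{i∈S_j} a_i = b_j. Let k be an index with e_{S_k} ∈ 𝓑', let X be a set of column indices with k ∉ X, and suppose that the k-th column of B, regarded as a vector of F^n, is an F-linear combination of the columns of B with indices in X. Then b_k ∈ Σ_{i∈X, e_i∈𝓑''} A_{e_i} + Σ_{j∈X, e_{S_j}∈𝓑'} B_{e_{S_j}}. -/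
/-- A `0`-`1` combination of vectors is the sum over the support of its coefficients. -/
theorem sum_intCast_smul_eq_sum_filter {F V ι : Type*} [Ring F] [AddCommGroup V] [Module F V]
    [Fintype ι] (v : ι → ℤ) (hv : ∀ j, v j = 0 ∨ v j = 1) (a : ι → V) :
    ∑ j, (v j : F) • a j = ∑ j ∈ Finset.univ.filter (fun j => v j = 1), a j := by
  rw [Finset.sum_filter]
  refine Finset.sum_congr rfl fun j _ => ?_
  rcases hv j with h | h <;> simp [h]

/-- For a 0-1 `n × n` matrix `B` with column supports `S i` and no full
columns (`𝓑''' = ∅`), a finite field `F`, and subspaces `A i`, `Bs j` (for columns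
`j ∈ 𝓑'`, i.e. `1 < |S j|`) of an `F`-vector space `V`: suppose `c = a 1 + ⋯ + a n` with
`a i ∈ A i`, and for every `j ∈ 𝓑'` there is `b j ∈ Bs j` with `Σ_{i ∈ S j} a i = b j`.
If `k` is an index with `e_{S k} ∈ 𝓑'`, `X` is a set of column indices with `k ∉ X`, and
the `k`-th column of `B`, regarded as a vector of `F^n`, is an `F`-linear combination of
the columns of `B` with indices in `X`, then
`b k ∈ Σ_{i ∈ X, e_i ∈ 𝓑''} A_{e_i} + Σ_{j ∈ X, e_{S j} ∈ 𝓑'} Bs j`. -/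
theorem statement6 {F : Type*} [Field F] [Fintype F] {V : Type*} [AddCommGroup V]
    [Module F V] {n : ℕ}
    (B : Matrix (Fin n) (Fin n) ℤ)
    (hB01 : ∀ j i, B j i = 0 ∨ B j i = 1)
    (S : Fin n → Finset (Fin n))
    (hS : ∀ i, S i = Finset.univ.filter fun j => B j i = 1)
    (hBppp : ∀ i, (S i).card < n)
    (A Bs : Fin n → Submodule F V)
    (c : V) (a : Fin n → V) (ha : ∀ i, a i ∈ A i) (hca : c = ∑ i, a i)
    (b : Fin n → V)
    (hb : ∀ j, 1 < (S j).card → b j ∈ Bs j ∧ ∑ i ∈ S j, a i = b j)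
    (k : Fin n) (hk : 1 < (S k).card)
    (X : Finset (Fin n)) (hkX : k ∉ X)
    (lam : Fin n → F)
    (hlin : ∀ j, ((B j k : F)) = ∑ i ∈ X, lam i * (B j i : F)) :
    b k ∈ (⨆ (i) (_ : i ∈ X ∧ (S i).card = 1), ⨆ l ∈ S i, A l) ⊔
      (⨆ (j) (_ : j ∈ X ∧ 1 < (S j).card), Bs j) := by
  have hcol : ∀ i, ∑ j, (B j i : F) • a j = ∑ j ∈ S i, a j := fun i => by
    rw [hS i]
    exact sum_intCast_smul_eq_sum_filter (fun j => B j i) (fun j => hB01 j i) a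
  have hsum : b k = ∑ i ∈ X, lam i • ∑ j ∈ S i, a j := by
    simp_rw [← (hb k hk).2, ← hcol, hlin, Finset.sum_smul, Finset.smul_sum, mul_smul]
    exact Finset.sum_comm
  rw [hsum]
  refine Submodule.sum_mem _ fun i hi => Submodule.smul_mem _ _ ?_
  rcases lt_trichotomy (S i).card 1 with h | h | h
  · rw [Finset.card_eq_zero.mp (Nat.lt_one_iff.mp h), Finset.sum_empty]
    exact Submodule.zero_mem _
  · refine Submodule.mem_sup_left (Submodule.sum_mem _ fun l hl => ?_)
    exact Submodule.mem_iSup_of_mem i (Submodule.mem_iSup_of_mem ⟨hi, h⟩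
      (Submodule.mem_iSup_of_mem l (Submodule.mem_iSup_of_mem hl (ha l))))
  · refine Submodule.mem_sup_right ?_
    rw [(hb i h).2]
    exact Submodule.mem_iSup_of_mem i (Submodule.mem_iSup_of_mem ⟨hi, h⟩ (hb i h).1)
end

section
/- Let n ≥ 7 and let t be an integer with 2 ≤ t ≤ ⌊(n−1)/2⌋ − 1, and set M := M(n,t) = n − t − 2. Let F be a finite field whose characteristic divides t, and let A_1, A_2, …, A_M, B_1, B_2, …, B_{t+1} and C be subspaces of a finite-dimensional F-vector space V. Then: H(C) ≤ (1/(t+3)) · [ Σ_{i∈[t+1]} H(A_i) + H(B_1) ] + H(C ∣ B_{[t+1]}, A_{[t+2, M]}) + H(C ∣ A_{[M]}) + Σ_{i∈[M]} I(C; A_{[M]−i}) + Σ_{i∈[t+1]} [ I(C; B_i) + H(C ∣ A_i, B_i) + I(C; A_{[M]−i}, B_i) ] + Σ_{i∈[t+1]} I(C; B_{[t+1]−i}, A_{[t+2, M]}) + Σ_{i∈[t+2, M]} I(C; B_{[t+1]}, A_{[t+2, M]−i}). -/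
open Module

/-- A linear map into a sum of two subspaces splits along the two summands. -/
theorem LinearMap.exists_add_of_mem_sup {F W V : Type*} [Field F] [AddCommGroup W] [Module F W]
    [AddCommGroup V] [Module F V] (g : W →ₗ[F] V) {P Q : Submodule F V}
    (h : ∀ w, g w ∈ P ⊔ Q) :
    ∃ p q : W →ₗ[F] V, (∀ w, p w ∈ P) ∧ (∀ w, q w ∈ Q) ∧ p + q = g := by
  let b := Basis.ofVectorSpace F W
  choose y hy z hz hyz using fun k ↦ Submodule.mem_sup.1 (h (b k))
  have mem_of_basis (R : Submodule F V) (x : _ → V) (hx : ∀ k, x k ∈ R) (w : W) :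
      b.constr F x w ∈ R := by
    rw [Basis.constr_apply]
    exact Submodule.sum_mem _ fun k _ ↦ R.smul_mem _ (hx k)
  refine ⟨b.constr F y, b.constr F z, mem_of_basis P y hy, mem_of_basis Q z hz, b.ext fun k ↦ ?_⟩
  simp [Basis.constr_basis, hyz]

/-- A linear map into a finite sum of subspaces splits along the summands. -/
theorem LinearMap.exists_sum_of_mem_iSup {F W V ι : Type*} [Field F] [AddCommGroup W]
    [Module F W] [AddCommGroup V] [Module F V] (S : Finset ι) (A : ι → Submodule F V)
    (g : W →ₗ[F] V) (h : ∀ w, g w ∈ ⨆ i ∈ S, A i) :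
    ∃ f : ι → W →ₗ[F] V, (∀ i ∈ S, ∀ w, f i w ∈ A i) ∧ ∑ i ∈ S, f i = g := by
  classical
  induction S using Finset.induction_on generalizing g with
  | empty => exact ⟨0, by simp, by ext w; simpa [eq_comm] using h w⟩
  | insert a S ha ih =>
    simp only [Finset.iSup_insert] at h
    obtain ⟨p, q, hp, hq, rfl⟩ := g.exists_add_of_mem_sup h
    obtain ⟨f, hf, rfl⟩ := ih q hq
    refine ⟨Function.update f a p, fun i hi w ↦ ?_, ?_⟩
    · obtain rfl | hia := eq_or_ne i a
      · simpa using hp w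
      · simpa [hia] using hf i (Finset.mem_of_mem_insert_of_ne hi hia) w
    · rw [Finset.sum_insert ha, Function.update_self, Finset.sum_update_of_notMem ha]

theorem Submodule.finrank_inf_add_finrank_inf_le {F V : Type*} [Field F] [AddCommGroup V]
    [Module F V] [FiniteDimensional F V] (C P Q : Submodule F V) :
    finrank F (C ⊓ P : Submodule F V) + finrank F (C ⊓ Q : Submodule F V)
      ≤ finrank F C + finrank F (C ⊓ (P ⊓ Q) : Submodule F V) := by
  rw [← Submodule.finrank_sup_add_finrank_inf_eq, ← inf_inf_distrib_left]
  gcongr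
  exact Submodule.finrank_mono (sup_le inf_le_left inf_le_left)

/-- Codimensions inside `C` are subadditive under intersection. -/
theorem Submodule.finrank_le_finrank_inf_iInf_add_sum {F V ι : Type*} [Field F] [AddCommGroup V]
    [Module F V] [FiniteDimensional F V] (S : Finset ι) (C : Submodule F V)
    (X : ι → Submodule F V) :
    (finrank F C : ℚ) ≤ finrank F (C ⊓ ⨅ i ∈ S, X i : Submodule F V)
      + ∑ i ∈ S, ((finrank F C : ℚ) - finrank F (C ⊓ X i : Submodule F V)) := by
  classical
  induction S using Finset.induction_on with
  | empty =>
    have h : ⨅ i ∈ (∅ : Finset ι), X i = ⊤ := by simp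
    rw [h, inf_top_eq, Finset.sum_empty, add_zero]
  | insert a S ha ih =>
    rw [Finset.sum_insert ha, Finset.iInf_insert]
    have h := Nat.cast_le (α := ℚ).2
      (Submodule.finrank_inf_add_finrank_inf_le C (X a) (⨅ i ∈ S, X i))
    push_cast at h
    linarith

theorem Submodule.finrank_iSup_le_sum {F V ι : Type*} [Field F] [AddCommGroup V]
    [Module F V] [FiniteDimensional F V] (S : Finset ι) (X : ι → Submodule F V) :
    finrank F (⨆ i ∈ S, X i : Submodule F V) ≤ ∑ i ∈ S, finrank F (X i) := by
  classical
  induction S using Finset.induction_on with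
  | empty => simp
  | insert a S ha ih =>
    rw [Finset.sum_insert ha, Finset.iSup_insert]
    exact (Submodule.finrank_add_le_finrank_add_finrank _ _).trans (by gcongr)

/-- Every subspace `C` contains a subspace disjoint from `N` of dimension at least
`dim C - dim N`. -/
theorem Submodule.exists_le_disjoint_finrank_le {F V : Type*} [Field F] [AddCommGroup V]
    [Module F V] [FiniteDimensional F V] (C N : Submodule F V) :
    ∃ D ≤ C, Disjoint D N ∧ finrank F C ≤ finrank F D + finrank F N := by
  obtain ⟨K, hK⟩ := N.exists_isCompl
  refine ⟨C ⊓ K, inf_le_left, hK.symm.disjoint.mono_left inf_le_right, ?_⟩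
  have hdim := Submodule.finrank_sup_add_finrank_inf_eq C K
  have hle := Submodule.finrank_le (C ⊔ K)
  have hcompl := Submodule.finrank_add_eq_of_isCompl hK
  omega

/-- The rank inequality for a subspace `D` on which all the error terms vanish. -/
theorem Submodule.card_add_two_mul_finrank_le {F V ι : Type*} [Field F] [AddCommGroup V]
    [Module F V] [FiniteDimensional F V] [DecidableEq ι] {R S : Finset ι} (hSR : S ⊆ R)
    (hS : 1 < S.card) (hcard : (S.card : F) = 1) {A B : ι → Submodule F V} {D : Submodule F V}
    (hA : D ≤ ⨆ i ∈ R, A i)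
    (hB : D ≤ (⨆ i ∈ S, B i) ⊔ ⨆ i ∈ R \ S, A i)
    (hAB : ∀ i ∈ S, D ≤ A i ⊔ B i)
    (disjA : ∀ i ∈ R, Disjoint D (⨆ j ∈ R.erase i, A j))
    (disjAB : ∀ i ∈ S, Disjoint D ((⨆ j ∈ R.erase i, A j) ⊔ B i))
    (disjB : ∀ i ∈ S, Disjoint D ((⨆ j ∈ S.erase i, B j) ⊔ ⨆ j ∈ R \ S, A j))
    {b : ι} (hb : b ∈ S) :
    ((S.card : ℚ) + 2) * finrank F D ≤ ∑ i ∈ S, (finrank F (A i) : ℚ) + finrank F (B b) := by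
  have eq_zero {Z : Submodule F V} (hZ : Disjoint D Z) (d : D) (hd : (d : V) ∈ Z) : d = 0 :=
    Subtype.ext (Submodule.disjoint_def.1 hZ d d.2 hd)
  have finrank_add_le {P Q X : Submodule F V} (hPQ : Disjoint P Q) (hP : P ≤ X) (hQ : Q ≤ X) :
      finrank F P + finrank F Q ≤ finrank F X := by
    rw [← Submodule.finrank_sup_add_finrank_inf_eq, hPQ.eq_bot, finrank_bot, add_zero]
    exact Submodule.finrank_mono (sup_le hP hQ)
  obtain ⟨f, hf, hfsum⟩ := LinearMap.exists_sum_of_mem_iSup R A D.subtype fun d ↦ hA d.2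
  have hgh : ∀ i ∈ S, ∃ g : D →ₗ[F] V, (∀ d, g d ∈ A i) ∧ ∀ d : D, (d : V) - g d ∈ B i := by
    intro i hi
    obtain ⟨g, h, hg, hh, hs⟩ := D.subtype.exists_add_of_mem_sup fun d ↦ hAB i hi d.2
    refine ⟨g, hg, fun d ↦ ?_⟩
    have : g d + h d = d := LinearMap.congr_fun hs d
    simpa [← this] using hh d
  choose! g hg hgB using hgh
  have split (i) (hi : i ∈ R) (d : D) : (d : V) - f i d ∈ ⨆ j ∈ R.erase i, A j := by
    have h : ∑ j ∈ R, f j d = d := by simpa using LinearMap.congr_fun hfsum d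
    rw [← h, ← Finset.add_sum_erase R _ hi, add_sub_cancel_left]
    exact Submodule.sum_mem_biSup fun j hj ↦ hf j (Finset.mem_of_mem_erase hj) d
  let u (i : ι) : D →ₗ[F] V := f i - g i
  let E : Submodule F D := ⨅ i ∈ S, LinearMap.ker (u i)
  have hE : ∀ e ∈ E, ∀ i ∈ S, f i e = g i e := by
    intro e he i hi
    simp only [E, Submodule.mem_iInf, LinearMap.mem_ker] at he
    exact sub_eq_zero.1 (he i hi)
  have boundA (i) (hi : i ∈ S) :
      finrank F D + finrank F (LinearMap.range (u i)) ≤ finrank F (A i) := by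
    have hinj : Function.Injective (f i) := by
      refine (injective_iff_map_eq_zero _).2 fun d hd ↦ eq_zero (disjA i (hSR hi)) d ?_
      simpa [hd] using split i (hSR hi) d
    have hdisj : Disjoint (LinearMap.range (f i)) (LinearMap.range (u i)) := by
      rw [Submodule.disjoint_def]
      rintro _ ⟨d, rfl⟩ ⟨e, he⟩
      suffices d = 0 by simp [this]
      refine eq_zero (disjAB i hi) d ?_
      have he' : f i e - g i e = f i d := he
      have : (d : V) = ((d - f i d) - (e - f i e)) + (e - g i e) := by
        rw [← he']; abel
      rw [this]
      exact Submodule.add_mem_sup (Submodule.sub_mem _ (split i (hSR hi) d) (split i (hSR hi) e))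
        (hgB i hi e)
    rw [← LinearMap.finrank_range_of_inj hinj]
    refine finrank_add_le hdisj ?_ ?_
    · rintro _ ⟨d, rfl⟩
      exact hf i (hSR hi) d
    · rintro _ ⟨d, rfl⟩
      exact Submodule.sub_mem _ (hf i (hSR hi) d) (hg i hi d)
  have boundB : finrank F D + finrank F E ≤ finrank F (B b) := by
    have hB' : D ≤ B b ⊔ ((⨆ j ∈ S.erase b, B j) ⊔ ⨆ j ∈ R \ S, A j) := by
      rwa [← sup_assoc, ← Finset.iSup_insert, Finset.insert_erase hb]
    obtain ⟨k, l, hk, hl, hkl⟩ := D.subtype.exists_add_of_mem_sup fun d ↦ hB' d.2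
    have hkl' (d : D) : k d + l d = d := LinearMap.congr_fun hkl d
    have hkinj : Function.Injective k := by
      refine (injective_iff_map_eq_zero _).2 fun d hd ↦ eq_zero (disjB b hb) d ?_
      rw [← hkl' d, hd, zero_add]
      exact hl d
    let h : E →ₗ[F] V := (D.subtype - g b).comp E.subtype
    have hhinj : Function.Injective h := by
      refine (injective_iff_map_eq_zero _).2 fun e he ↦ Subtype.ext ?_
      obtain ⟨c, hc, hcb⟩ := Finset.exists_mem_ne hS b
      refine eq_zero (disjA c (hSR hc)) e ?_
      have he' : ((e : D) : V) = g b e := sub_eq_zero.1 he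
      rw [he']
      exact Submodule.mem_iSup_of_mem b
        (Submodule.mem_iSup_of_mem (Finset.mem_erase.2 ⟨hcb.symm, hSR hb⟩) (hg b hb e))
    have hdisj : Disjoint (LinearMap.range k) (LinearMap.range h) := by
      rw [Submodule.disjoint_def]
      rintro _ ⟨d, rfl⟩ ⟨e, he⟩
      suffices d = 0 by simp [this]
      refine eq_zero (disjB b hb) d ?_
      have he' : ((e : D) : V) - g b e = k d := he
      have hfe : ∑ i ∈ S, f i e + ∑ i ∈ R \ S, f i e = ((e : D) : V) := by
        rw [add_comm, Finset.sum_sdiff hSR]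
        simpa using LinearMap.congr_fun hfsum e
      have hge : ∑ i ∈ S, (((e : D) : V) - g i e) = ∑ i ∈ R \ S, f i e := by
        rw [Finset.sum_sub_distrib, Finset.sum_const, ← Nat.cast_smul_eq_nsmul F, hcard, one_smul,
          ← Finset.sum_congr rfl (hE e e.2), sub_eq_iff_eq_add', hfe]
      rw [← Finset.add_sum_erase S _ hb, he', ← eq_sub_iff_add_eq, sub_eq_neg_add] at hge
      rw [← hkl' d, hge]
      refine Submodule.add_mem _ (Submodule.add_mem_sup (Submodule.neg_mem _ ?_) ?_) (hl d)
      · exact Submodule.sum_mem_biSup fun j hj ↦ hgB j (Finset.mem_of_mem_erase hj) e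
      · exact Submodule.sum_mem_biSup fun j hj ↦ hf j (Finset.mem_sdiff.1 hj).1 e
    rw [← LinearMap.finrank_range_of_inj hkinj, ← LinearMap.finrank_range_of_inj hhinj]
    refine finrank_add_le hdisj ?_ ?_
    · rintro _ ⟨d, rfl⟩
      exact hk d
    · rintro _ ⟨e, rfl⟩
      exact hgB b hb e
  have boundE : (finrank F D : ℚ) ≤ finrank F E
      + ∑ i ∈ S, (finrank F (LinearMap.range (u i)) : ℚ) := by
    have h := Submodule.finrank_le_finrank_inf_iInf_add_sum S ⊤ fun i ↦ LinearMap.ker (u i)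
    rw [top_inf_eq, finrank_top] at h
    refine h.trans_eq (congrArg (_ + ·) (Finset.sum_congr rfl fun i _ ↦ ?_))
    rw [top_inf_eq, ← (u i).finrank_range_add_finrank_ker]
    push_cast
    ring
  have hsum : ∑ i ∈ S, ((finrank F D : ℚ) + finrank F (LinearMap.range (u i)))
      ≤ ∑ i ∈ S, (finrank F (A i) : ℚ) :=
    Finset.sum_le_sum fun i hi ↦ mod_cast boundA i hi
  rw [Finset.sum_add_distrib, Finset.sum_const, nsmul_eq_mul] at hsum
  have boundB' : (finrank F D : ℚ) + finrank F E ≤ finrank F (B b) := mod_cast boundB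
  linarith

/-- for `n ≥ 7`, `2 ≤ t ≤ ⌊(n−1)/2⌋ − 1` and `M = M(n,t) = n − t − 2`, a
characteristic-dependent linear rank inequality over finite fields whose characteristic
divides `t`, for subspaces `A 1, …, A M`, `B 1, …, B (t+1)` and `C` of a finite-dimensional
`F`-vector space.  Here `H(X) = dim X`, `I(X; Y…) = dim (X ⊓ ΣY)`,
`H(X ∣ Y…) = dim X − dim (X ⊓ ΣY)`, `A_{[M]} = A 1 + ⋯ + A M`, `A_{[M]−i} = Σ_{j≠i} A j`,
`A_{[t+2,M]} = Σ_{j=t+2}^{M} A j`, `A_{[t+2,M]−i} = Σ_{j∈[t+2,M], j≠i} A j`,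
`B_{[t+1]} = B 1 + ⋯ + B (t+1)` and `B_{[t+1]−i} = Σ_{j∈[t+1], j≠i} B j`. -/
theorem statement10 {F : Type*} [Field F] [Fintype F] {V : Type*} [AddCommGroup V]
    [Module F V] [FiniteDimensional F V]
    (n t M : ℕ) (hn : 7 ≤ n) (ht2 : 2 ≤ t) (ht : t ≤ (n - 1) / 2 - 1)
    (hM : M = n - t - 2)
    (hchar : (ringChar F : ℕ) ∣ t)
    (A B : ℕ → Submodule F V) (C : Submodule F V) :
    (Module.finrank F C : ℚ) ≤
      (1 / (t + 3 : ℚ)) *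
        ((∑ i ∈ Finset.Icc 1 (t + 1), (Module.finrank F (A i) : ℚ))
          + (Module.finrank F (B 1) : ℚ))
      + ((Module.finrank F C : ℚ)
          - (Module.finrank F ((C ⊓ ((⨆ i ∈ Finset.Icc 1 (t + 1), B i) ⊔
              (⨆ i ∈ Finset.Icc (t + 2) M, A i)) : Submodule F V)) : ℚ))
      + ((Module.finrank F C : ℚ)
          - (Module.finrank F ((C ⊓ ⨆ i ∈ Finset.Icc 1 M, A i : Submodule F V)) : ℚ))
      + ∑ i ∈ Finset.Icc 1 M,
          (Module.finrank F ((C ⊓ ⨆ j ∈ (Finset.Icc 1 M).erase i, A j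
            : Submodule F V)) : ℚ)
      + ∑ i ∈ Finset.Icc 1 (t + 1),
          ((Module.finrank F ((C ⊓ B i : Submodule F V)) : ℚ)
            + ((Module.finrank F C : ℚ)
                - (Module.finrank F ((C ⊓ (A i ⊔ B i) : Submodule F V)) : ℚ))
            + (Module.finrank F ((C ⊓ ((⨆ j ∈ (Finset.Icc 1 M).erase i, A j) ⊔ B i)
                : Submodule F V)) : ℚ))
      + ∑ i ∈ Finset.Icc 1 (t + 1),
          (Module.finrank F ((C ⊓ ((⨆ j ∈ (Finset.Icc 1 (t + 1)).erase i, B j) ⊔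
            (⨆ j ∈ Finset.Icc (t + 2) M, A j)) : Submodule F V)) : ℚ)
      + ∑ i ∈ Finset.Icc (t + 2) M,
          (Module.finrank F ((C ⊓ ((⨆ j ∈ Finset.Icc 1 (t + 1), B j) ⊔
            (⨆ j ∈ (Finset.Icc (t + 2) M).erase i, A j)) : Submodule F V)) : ℚ) := by
  have hM' : t + 1 ≤ M := by omega
  have htF : (t : F) = 0 := (ringChar.spec F t).2 hchar
  set S := Finset.Icc 1 (t + 1) with hS
  set R := Finset.Icc 1 M with hR
  have hSR : S ⊆ R := Finset.Icc_subset_Icc_right hM'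
  have hT : Finset.Icc (t + 2) M = R \ S := by
    ext i
    simp only [hR, hS, Finset.mem_sdiff, Finset.mem_Icc]
    omega
  have hSc : S.card = t + 1 := by simp [hS]
  rw [hT]
  have h1S : 1 ∈ S := by simp [hS]
  clear_value S R
  let X₁ := (⨆ i ∈ S, B i) ⊔ ⨆ i ∈ R \ S, A i
  let X₂ := ⨆ i ∈ R, A i
  let Z₁ (i : ℕ) := C ⊓ ⨆ j ∈ R.erase i, A j
  let Z₂ (i : ℕ) := C ⊓ ((⨆ j ∈ R.erase i, A j) ⊔ B i)
  let Z₃ (i : ℕ) := C ⊓ ((⨆ j ∈ S.erase i, B j) ⊔ ⨆ j ∈ R \ S, A j)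
  let X₃ := ⨅ i ∈ S, A i ⊔ B i
  let N := (⨆ i ∈ R, Z₁ i) ⊔ ((⨆ i ∈ S, Z₂ i) ⊔ ⨆ i ∈ S, Z₃ i)
  obtain ⟨D, hDle, hDN, hD⟩ := Submodule.exists_le_disjoint_finrank_le (C ⊓ (X₁ ⊓ (X₂ ⊓ X₃))) N
  have hDC : D ≤ C := hDle.trans inf_le_left
  have hDX : D ≤ X₁ ∧ D ≤ X₂ ∧ D ≤ X₃ := by simpa using hDle.trans inf_le_right
  have disj {Z : Submodule F V} (hZ : C ⊓ Z ≤ N) : Disjoint D Z := by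
    rw [disjoint_iff_inf_le]
    exact (le_inf inf_le_left ((inf_le_inf_right Z hDC).trans hZ)).trans hDN.le_bot
  have hcore := Submodule.card_add_two_mul_finrank_le hSR (by omega) (by simp [hSc, htF])
    hDX.2.1 hDX.1 (fun i hi ↦ hDX.2.2.trans (iInf₂_le i hi))
    (fun i hi ↦ disj ((le_iSup₂ (f := fun i _ ↦ Z₁ i) i hi).trans le_sup_left))
    (fun i hi ↦ disj ((le_iSup₂ (f := fun i _ ↦ Z₂ i) i hi).trans
      (le_sup_left.trans le_sup_right)))
    (fun i hi ↦ disj ((le_iSup₂ (f := fun i _ ↦ Z₃ i) i hi).trans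
      (le_sup_right.trans le_sup_right))) h1S
  have hN : finrank F N ≤ ∑ i ∈ R, finrank F (Z₁ i)
      + (∑ i ∈ S, finrank F (Z₂ i) + ∑ i ∈ S, finrank F (Z₃ i)) :=
    (Submodule.finrank_add_le_finrank_add_finrank _ _).trans <| add_le_add
      (Submodule.finrank_iSup_le_sum R Z₁) <|
      (Submodule.finrank_add_le_finrank_add_finrank _ _).trans <| add_le_add
        (Submodule.finrank_iSup_le_sum S Z₂) (Submodule.finrank_iSup_le_sum S Z₃)
  have codim_inf (P Q : Submodule F V) : (finrank F (C ⊓ P : Submodule F V) : ℚ)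
      + finrank F (C ⊓ Q : Submodule F V)
      ≤ finrank F C + finrank F (C ⊓ (P ⊓ Q) : Submodule F V) :=
    mod_cast Submodule.finrank_inf_add_finrank_inf_le C P Q
  have hC₁ := codim_inf X₁ (X₂ ⊓ X₃)
  have hC₂ := codim_inf X₂ X₃
  have hC₃ := Submodule.finrank_le_finrank_inf_iInf_add_sum S C fun i ↦ A i ⊔ B i
  have hD' : (finrank F (C ⊓ (X₁ ⊓ (X₂ ⊓ X₃)) : Submodule F V) : ℚ)
      ≤ finrank F D + (∑ i ∈ R, (finrank F (Z₁ i) : ℚ)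
      + (∑ i ∈ S, (finrank F (Z₂ i) : ℚ) + ∑ i ∈ S, (finrank F (Z₃ i) : ℚ))) :=
    mod_cast hD.trans (by gcongr)
  have hcore' : (finrank F D : ℚ) ≤ 1 / (t + 3 : ℚ)
      * (∑ i ∈ S, (finrank F (A i) : ℚ) + finrank F (B 1)) := by
    rw [one_div, le_inv_mul_iff₀ (by positivity)]
    refine le_trans (le_of_eq ?_) hcore
    rw [hSc]
    push_cast
    ring
  have hB : 0 ≤ ∑ i ∈ S, (finrank F (C ⊓ B i : Submodule F V) : ℚ) := by positivity
  have hlast : 0 ≤ ∑ i ∈ R \ S, (finrank F (C ⊓ ((⨆ j ∈ S, B j) ⊔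
      ⨆ j ∈ (R \ S).erase i, A j) : Submodule F V) : ℚ) := by positivity
  rw [Finset.sum_add_distrib, Finset.sum_add_distrib]
  linarith
end
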